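/- For any infinite set X ⊆ ℕ, if A ∈ (I_X)*, i.e., the complement of A belongs to I_X, then A has upper asymptotic density 1: limsup_{n→∞} |A ∩ {1,…,n}|/n = 1. -/

import Mathlib

open Filter Set

/-- For an infinite `X = {x₁ < x₂ < …} ⊆ ℕ`, `fX X i = 1 / xₙ` where `xₙ` is the least
element of `X` with `i ≤ xₙ` (equivalently, `i ∈ (x_{n-1}, xₙ]`, with `x₀ = 0`). -/
noncomputable def fX (X : Set ℕ) (i : ℕ) : ℝ :=
  1 / (sInf {x | x ∈ X ∧ i ≤ x} : ℕ)


lemma fX_ge (X : Set ℕ) (x i : ℕ) (hx : x ∈ X) (hi : 1 ≤ i) (hix : i ≤ x) :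
    (1 : ℝ) / x ≤ fX X i := by
  unfold fX
  have hmem : x ∈ {x | x ∈ X ∧ i ≤ x} := ⟨hx, hix⟩
  have h1 : sInf {x | x ∈ X ∧ i ≤ x} ≤ x := Nat.sInf_le hmem
  have h2 := Nat.sInf_mem (s := {x | x ∈ X ∧ i ≤ x}) ⟨x, hmem⟩
  have h3 : 0 < sInf {x | x ∈ X ∧ i ≤ x} := lt_of_lt_of_le hi h2.2
  exact one_div_le_one_div_of_le (by exact_mod_cast h3) (by exact_mod_cast h1)

lemma ratio_le_one (A : Set ℕ) (n : ℕ) :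
    ((A ∩ Set.Icc 1 n).ncard : ℝ) / (n : ℝ) ≤ 1 := by
  apply div_le_one_of_le₀ _ (Nat.cast_nonneg n)
  have := Set.ncard_le_ncard (Set.inter_subset_right : A ∩ Set.Icc 1 n ⊆ Set.Icc 1 n)
    (Set.finite_Icc 1 n)
  simp at this
  exact_mod_cast this

open Classical in
lemma freq_ge (X : Set ℕ) (hX : X.Infinite) (A : Set ℕ)
    (hA : Summable ((Aᶜ).indicator (fX X))) (ε : ℝ) (hε : 0 < ε) :
    ∃ᶠ n : ℕ in atTop, 1 - 2 * ε ≤ ((A ∩ Set.Icc 1 n).ncard : ℝ) / (n : ℝ) := by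
  obtain ⟨s, hs⟩ := summable_iff_vanishing_norm.1 hA ε hε
  obtain ⟨M, hM⟩ := exists_nat_ge ((s.card : ℝ) / ε)
  rw [frequently_atTop]
  intro N
  obtain ⟨x, hx, hxN⟩ := hX.exists_gt (max N M)
  have hNx : N < x := lt_of_le_of_lt (le_max_left _ _) hxN
  have hMx : M < x := lt_of_le_of_lt (le_max_right _ _) hxN
  refine ⟨x, hNx.le, ?_⟩
  have hx0 : (0 : ℝ) < x := by exact_mod_cast (Nat.zero_le N).trans_lt hNx
  have hsx : (s.card : ℝ) ≤ ε * x := by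
    have : (s.card : ℝ) / ε ≤ x := hM.trans (by exact_mod_cast hMx.le)
    rw [div_le_iff₀ hε] at this
    linarith
  set P := (Finset.Icc 1 x).filter (· ∈ A) with hP
  set B := (Finset.Icc 1 x).filter (¬ · ∈ A) with hB
  have hcard : P.card + B.card = x := by
    rw [hP, hB, Finset.card_filter_add_card_filter_not]; simp
  have hn : (A ∩ Set.Icc 1 x).ncard = P.card := by
    rw [← Set.ncard_coe_finset]
    congr 1
    ext i; simp [hP]; tauto
  have ht := hs (B \ s) Finset.sdiff_disjoint
  have hlow : ((B \ s).card : ℝ) * (1 / x) ≤ ∑ i ∈ B \ s, (Aᶜ).indicator (fX X) i := by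
    rw [← nsmul_eq_mul]
    apply Finset.card_nsmul_le_sum
    intro i hi
    simp only [hB, Finset.mem_sdiff, Finset.mem_filter, Finset.mem_Icc] at hi
    rw [Set.indicator_of_mem (by exact hi.1.2)]
    exact fX_ge X x i hx hi.1.1.1 hi.1.1.2
  have h1 : ((B \ s).card : ℝ) * (1 / x) < ε :=
    hlow.trans_lt ((le_abs_self _).trans_lt ht)
  rw [mul_one_div, div_lt_iff₀ hx0] at h1
  have h2 : (B.card : ℝ) ≤ (B \ s).card + s.card := by
    have := Finset.card_le_card_sdiff_add_card (s := B) (t := s)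
    exact_mod_cast this
  have h3 : (P.card : ℝ) + B.card = x := by exact_mod_cast hcard
  rw [hn, le_div_iff₀ hx0]
  linarith

/-- If the complement of `A` belongs to the ideal `I_X` (i.e. `A ∈ (I_X)^*`), then `A`
has upper asymptotic density `1`. -/
theorem upper_density_of_mem_dual_IX (X : Set ℕ) (hX : X.Infinite) (A : Set ℕ)
    (hA : Summable ((Aᶜ).indicator (fX X))) :
    Filter.limsup (fun n : ℕ => ((A ∩ Set.Icc 1 n).ncard : ℝ) / (n : ℝ)) atTop = 1 := by
  have hb : IsBoundedUnder (· ≤ ·) atTop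
      (fun n : ℕ => ((A ∩ Set.Icc 1 n).ncard : ℝ) / (n : ℝ)) :=
    isBoundedUnder_of ⟨1, ratio_le_one A⟩
  have hb' : IsBoundedUnder (· ≥ ·) atTop
      (fun n : ℕ => ((A ∩ Set.Icc 1 n).ncard : ℝ) / (n : ℝ)) :=
    isBoundedUnder_of ⟨0, fun n => by positivity⟩
  apply le_antisymm
  · exact limsup_le_of_le hb'.isCoboundedUnder_le (Eventually.of_forall (ratio_le_one A))
  · apply le_of_forall_pos_le_add
    intro ε hε
    have := le_limsup_of_frequently_le (freq_ge X hX A hA (ε / 2) (by linarith)) hb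
    linarith
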